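/- Let N ≥ 1 and R ≥ 2 be integers and let ω ∈ [−1/2, N − 1/2). Then ∫₀¹ |e^{2πiωx} − ∑_{ℓ ∈ I_{N,R}} G(ω − ℓ) e^{2πiℓx}|² dx ≤ 2/(π²(R − 3/2)). -/

import Mathlib

open MeasureTheory

/-- The kernel `G(t) = e^{πit} · sin(πt)/(πt)` for `t ≠ 0`, with `G(0) = 1`. -/
noncomputable def G (t : ℝ) : ℂ :=
  if t = 0 then 1
  else Complex.exp (Real.pi * Complex.I * t) * (Real.sin (Real.pi * t) : ℂ) / ((Real.pi * t : ℝ) : ℂ)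

/-- `G` is the Fourier integral of the indicator of `[0, 1]`. -/
theorem integral_exp_eq_G (t : ℝ) :
    ∫ x in (0:ℝ)..1, Complex.exp (2 * Real.pi * Complex.I * t * x) = G t := by
  by_cases ht : t = 0
  · simp [G, ht]
  have htC : (t : ℂ) ≠ 0 := by exact_mod_cast ht
  have hpi : (Real.pi : ℂ) ≠ 0 := by exact_mod_cast Real.pi_ne_zero
  have hc : 2 * Real.pi * Complex.I * t ≠ 0 := by simp [htC, hpi]
  have hexp : Complex.exp (2 * Real.pi * Complex.I * t) =
      Complex.exp (Real.pi * t * Complex.I) * Complex.exp (Real.pi * t * Complex.I) := by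
    rw [← Complex.exp_add]
    ring_nf
  have hcancel : Complex.exp (Real.pi * t * Complex.I) *
      Complex.exp (-(Real.pi * t) * Complex.I) = 1 := by
    rw [← Complex.exp_add]
    ring_nf
    simp
  rw [integral_exp_mul_complex hc, G, if_neg ht, Complex.ofReal_sin, Complex.sin]
  push_cast
  rw [show (Real.pi : ℂ) * Complex.I * t = Real.pi * t * Complex.I by ring]
  simp only [mul_one, mul_zero, Complex.exp_zero]
  rw [hexp, div_eq_div_iff hc (mul_ne_zero hpi htC)]
  linear_combination (Real.pi * t : ℂ) * hcancel - (Real.pi * t : ℂ) *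
    (Complex.exp (Real.pi * t * Complex.I) * Complex.exp (-(Real.pi * t) * Complex.I) -
      Complex.exp (Real.pi * t * Complex.I) ^ 2) * Complex.I_sq

theorem G_intCast (n : ℤ) : G n = if n = 0 then 1 else 0 := by
  simp [G, mul_comm Real.pi, Real.sin_int_mul_pi]

theorem norm_G_sq_le {t : ℝ} {a : ℝ} (ha : 0 < a) (hat : a ≤ |t|) :
    ‖G t‖ ^ 2 ≤ 1 / (Real.pi ^ 2 * a ^ 2) := by
  have ht : t ≠ 0 := abs_pos.mp (ha.trans_le hat)
  have hnorm : ‖G t‖ = |Real.sin (Real.pi * t)| / (Real.pi * |t|) := by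
    rw [G, if_neg ht, show (Real.pi : ℂ) * Complex.I * t = ((Real.pi * t : ℝ) : ℂ) * Complex.I by
      push_cast; ring, norm_div, norm_mul, Complex.norm_exp_ofReal_mul_I, Complex.norm_real,
      Complex.norm_real, one_mul, Real.norm_eq_abs, Real.norm_eq_abs, abs_mul,
      abs_of_pos Real.pi_pos]
  rw [hnorm, div_pow, mul_pow]
  gcongr
  exact pow_le_one₀ (abs_nonneg _) (Real.abs_sin_le_one _)

theorem fourierCoeffOn_exp_sub_sum (ω : ℝ) (s : Finset ℤ) (n : ℤ) :
    fourierCoeffOn zero_lt_one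
      (fun x : ℝ => Complex.exp (2 * Real.pi * Complex.I * ω * x) -
        ∑ ℓ ∈ s, G (ω - ℓ) * Complex.exp (2 * Real.pi * Complex.I * ℓ * x)) n =
      if n ∈ s then 0 else G (ω - n) := by
  have hsplit (x : ℝ) : fourier (-n) (x : AddCircle ((1 : ℝ) - 0)) •
      (Complex.exp (2 * Real.pi * Complex.I * ω * x) -
        ∑ ℓ ∈ s, G (ω - ℓ) * Complex.exp (2 * Real.pi * Complex.I * ℓ * x)) =
      Complex.exp (2 * Real.pi * Complex.I * (ω - n : ℝ) * x) -
        ∑ ℓ ∈ s, G (ω - ℓ) *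
          Complex.exp (2 * Real.pi * Complex.I * (((ℓ - n : ℤ) : ℝ) : ℂ) * x) := by
    rw [fourier_coe_apply, smul_eq_mul, mul_sub, Finset.mul_sum, ← Complex.exp_add]
    congr 1
    · congr 1
      push_cast
      ring
    · refine Finset.sum_congr rfl fun ℓ _ => ?_
      rw [mul_left_comm, ← Complex.exp_add]
      congr 2
      push_cast
      ring
  rw [fourierCoeffOn_eq_integral]
  simp_rw [hsplit]
  rw [intervalIntegral.integral_sub, intervalIntegral.integral_finsetSum]
  · simp_rw [intervalIntegral.integral_const_mul, integral_exp_eq_G, G_intCast, sub_eq_zero]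
    split_ifs with h <;> simp [h]
  · exact fun ℓ _ => Continuous.intervalIntegrable (by fun_prop) _ _
  · exact Continuous.intervalIntegrable (by fun_prop) _ _
  · exact Continuous.intervalIntegrable (by fun_prop) _ _

theorem sum_Icc_le_of_tail_le {c : ℤ → ℝ} {N R : ℕ} {C : ℝ} (hR : 0 < R) (hC : 0 ≤ C)
    (hzero : ∀ n ∈ Finset.Icc (-(R : ℤ)) (N - 1 + R), c n = 0)
    (hright : ∀ K : ℕ, c (N + R + K) ≤ C / (R + K + 1 / 2) ^ 2)
    (hleft : ∀ K : ℕ, c (-R - 1 - K) ≤ C / (R + K + 1 / 2) ^ 2) (K : ℕ) :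
    ∑ n ∈ Finset.Icc (-(R : ℤ) - K) (N - 1 + R + K), c n ≤
      2 * C * (1 / R - 1 / (R + K)) := by
  induction K with
  | zero => simpa using (Finset.sum_eq_zero hzero).le
  | succ K ih =>
    have hset : Finset.Icc (-(R : ℤ) - (K + 1 : ℕ)) (N - 1 + R + (K + 1 : ℕ)) =
        insert (N + R + K : ℤ) (insert (-R - 1 - K : ℤ)
          (Finset.Icc (-(R : ℤ) - K) (N - 1 + R + K))) := by
      ext n
      simp only [Finset.mem_Icc, Finset.mem_insert]
      omega
    have hx : (0 : ℝ) < R + K := by positivity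
    have hstep : C / ((R : ℝ) + K + 1 / 2) ^ 2 ≤
        C * (1 / ((R : ℝ) + K) - 1 / (R + K + 1)) := by
      rw [div_eq_mul_one_div]
      refine mul_le_mul_of_nonneg_left ?_ hC
      rw [div_sub_div _ _ (by positivity) (by positivity),
        div_le_div_iff₀ (by positivity) (by positivity)]
      nlinarith
    rw [hset, Finset.sum_insert, Finset.sum_insert]
    · have h₁ := hright K
      have h₂ := hleft K
      push_cast
      rw [← add_assoc (R : ℝ)]
      linarith
    · simp only [Finset.mem_Icc]
      omega
    · simp only [Finset.mem_Icc, Finset.mem_insert]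
      omega

theorem truncation_error_L2_bound (N R : ℕ) (hN : 1 ≤ N) (hR : 2 ≤ R)
    (ω : ℝ) (hω : ω ∈ Set.Ico (-(1 : ℝ) / 2) ((N : ℝ) - 1 / 2)) :
    (∫ x in (0:ℝ)..1,
        ‖Complex.exp (2 * Real.pi * Complex.I * ω * x) -
          ∑ ℓ ∈ Finset.Icc (-(R : ℤ)) ((N : ℤ) - 1 + R),
            G (ω - ℓ) * Complex.exp (2 * Real.pi * Complex.I * ℓ * x)‖ ^ 2) ≤
      2 / (Real.pi ^ 2 * ((R : ℝ) - 3 / 2)) := by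
  have hRpos : (2 : ℝ) ≤ R := by exact_mod_cast hR
  set s := Finset.Icc (-(R : ℤ)) ((N : ℤ) - 1 + R) with hs
  set f : ℝ → ℂ := fun x => Complex.exp (2 * Real.pi * Complex.I * ω * x) -
    ∑ ℓ ∈ s, G (ω - ℓ) * Complex.exp (2 * Real.pi * Complex.I * ℓ * x) with hf
  have hcont : Continuous f := by fun_prop
  have hL2 : MemLp f 2 (volume.restrict (Set.Ioc 0 1)) :=
    (memLp_two_iff_integrable_sq_norm hcont.aestronglyMeasurable).mpr
      ((hcont.norm.pow 2).integrableOn_Ioc)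
  have hparseval := tsum_sq_fourierCoeffOn zero_lt_one hL2
  simp only [hf, fourierCoeffOn_exp_sub_sum, sub_zero, inv_one, one_smul] at hparseval
  rw [← hparseval]
  set c : ℤ → ℝ := fun n => ‖if n ∈ s then 0 else G (ω - n)‖ ^ 2 with hc
  have hc_le {n : ℤ} {K : ℕ} (h : (R : ℝ) + K + 1 / 2 ≤ |ω - n|) :
      c n ≤ 1 / Real.pi ^ 2 / (R + K + 1 / 2) ^ 2 := by
    simp only [hc]
    split_ifs
    · simp only [norm_zero]
      rw [zero_pow two_ne_zero]
      positivity
    · rw [div_div]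
      exact_mod_cast norm_G_sq_le (by positivity) h
  have hbound := sum_Icc_le_of_tail_le (c := c) (N := N) (R := R) (C := 1 / Real.pi ^ 2)
    (by omega) (by positivity) (fun n hn => by simp only [hc, hs, if_pos hn, norm_zero]; norm_num)
    (fun K => hc_le <| by
      rw [abs_sub_comm]
      refine le_trans ?_ (le_abs_self _)
      push_cast
      linarith [hω.2])
    (fun K => hc_le <| by
      refine le_trans ?_ (le_abs_self _)
      push_cast
      linarith [hω.1])
  refine Real.tsum_le_of_sum_le (fun n => by positivity) fun t => ?_
  obtain ⟨K, hK⟩ : ∃ K : ℕ, t ⊆ Finset.Icc (-(R : ℤ) - K) (N - 1 + R + K) := by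
    refine ⟨t.sup Int.natAbs, fun n hn => ?_⟩
    have := Finset.le_sup (f := Int.natAbs) hn
    simp only [Finset.mem_Icc]
    omega
  calc ∑ n ∈ t, c n
      ≤ ∑ n ∈ Finset.Icc (-(R : ℤ) - K) (N - 1 + R + K), c n :=
        Finset.sum_le_sum_of_subset_of_nonneg hK fun _ _ _ => by positivity
    _ ≤ 2 * (1 / Real.pi ^ 2) * (1 / R - 1 / (R + K)) := hbound K
    _ ≤ 2 * (1 / Real.pi ^ 2) * (1 / (R - 3 / 2)) := by
        have h₁ : (1 : ℝ) / R ≤ 1 / (R - 3 / 2) :=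
          one_div_le_one_div_of_le (by linarith) (by linarith)
        have h₂ : (0 : ℝ) ≤ 1 / (R + K) := by positivity
        gcongr
        linarith
    _ = 2 / (Real.pi ^ 2 * ((R : ℝ) - 3 / 2)) := by
        rw [mul_assoc, one_div_mul_one_div, mul_one_div]
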